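/- For the action of G₃₅₁ on subsets of G₃₅₁ by left translation, the number of subsets S ⊆ G₃₅₁ whose stabilizer is the trivial subgroup equals 2³⁵¹ − 13·2¹¹⁷ + 39·2³⁹ − 27·(2²⁷ + 2¹³ − 2). -/

import Mathlib

open Pointwise

/-- `F₂₇`, a finite field with 27 elements. -/
abbrev F27 : Type := GaloisField 3 3

/-- `a` is a nonzero square in `F₂₇`. -/
def IsNonzeroSquare (a : F27) : Prop := a ≠ 0 ∧ ∃ c : F27, a = c ^ 2

/-- The set of affine permutations `x ↦ a·x + b` with `a` a nonzero square. -/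
def affineSet : Set (Equiv.Perm F27) :=
  { g | ∃ a b : F27, IsNonzeroSquare a ∧ ∀ x : F27, g x = a * x + b }

set_option linter.unusedSectionVars false

theorem numFixed {G : Type*} [Group G] [Finite G] (H : Subgroup G) :
    Nat.card {S : Set G // H ≤ MulAction.stabilizer G S} = 2 ^ H.index := by
  have e : {S : Set G // H ≤ MulAction.stabilizer G S} ≃
      Set (Quotient (QuotientGroup.rightRel H)) :=
    { toFun := fun S => Quotient.mk _ '' S.1
      invFun := fun U => ⟨Quotient.mk _ ⁻¹' U, by
        intro h hh
        rw [MulAction.mem_stabilizer_iff]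
        ext x
        rw [Set.mem_smul_set_iff_inv_smul_mem, Set.mem_preimage, Set.mem_preimage]
        have : (Quotient.mk (QuotientGroup.rightRel H) (h⁻¹ • x)) = Quotient.mk _ x := by
          apply Quotient.sound
          change QuotientGroup.rightRel H _ _
          rw [QuotientGroup.rightRel_apply]
          simpa using hh
        rw [this]⟩
      left_inv := by
        rintro ⟨S, hS⟩
        ext x
        simp only [Set.mem_preimage, Set.mem_image]
        constructor
        · rintro ⟨y, hy, hxy⟩
          have := Quotient.exact hxy
          change QuotientGroup.rightRel H _ _ at this
          rw [QuotientGroup.rightRel_apply] at this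
          have h2 := hS this
          rw [MulAction.mem_stabilizer_iff] at h2
          rw [← h2, Set.mem_smul_set]
          exact ⟨y, hy, by simp⟩
        · intro hx
          exact ⟨x, hx, rfl⟩
      right_inv := by
        intro U
        exact Set.image_preimage_eq _ Quotient.mk_surjective }
  rw [Nat.card_congr e, Subgroup.index, 
    ← Nat.card_congr (QuotientGroup.quotientRightRelEquivQuotientLeftRel H)]
  have : Finite (Quotient (QuotientGroup.rightRel H)) := Quotient.finite _
  have := Fintype.ofFinite (Quotient (QuotientGroup.rightRel H))
  rw [Nat.card_eq_fintype_card, Nat.card_eq_fintype_card, Fintype.card_set]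

theorem indepCount {F : Type*} [AddCommGroup F] [Module (ZMod 3) F] [Finite F]
    (V : Submodule (ZMod 3) F) (k : ℕ) :
    Nat.card {s : {s : Fin k → F // LinearIndependent (ZMod 3) s} // ∀ i, s.1 i ∈ V} =
      ∏ i : Fin k, (3 ^ (Module.finrank (ZMod 3) V) - 3 ^ (i : ℕ)) := by
  have : Fact (Nat.Prime 3) := ⟨by norm_num⟩
  have e : {s : {s : Fin k → F // LinearIndependent (ZMod 3) s} // ∀ i, s.1 i ∈ V} ≃
      {s : Fin k → V // LinearIndependent (ZMod 3) s} :=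
    { toFun := fun s => ⟨fun i => ⟨s.1.1 i, s.2 i⟩, by
        have := s.1.2
        apply LinearIndependent.of_comp V.subtype
        exact this⟩
      invFun := fun s => ⟨⟨fun i => (s.1 i : F), by
        exact s.2.map' V.subtype (Submodule.ker_subtype V)⟩, fun i => (s.1 i).2⟩
      left_inv := fun s => rfl
      right_inv := fun s => rfl }
  rw [Nat.card_congr e]
  by_cases hk : k ≤ Module.finrank (ZMod 3) V
  · have := Fintype.ofFinite V
    have := card_linearIndependent (K := ZMod 3) (V := V) hk
    simpa [Nat.card_eq_fintype_card] using this
  · have : IsEmpty {s : Fin k → V // LinearIndependent (ZMod 3) s} := by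
      refine ⟨fun s => hk ?_⟩
      simpa using s.2.fintype_card_le_finrank
    rw [Nat.card_of_isEmpty]
    symm
    apply Finset.prod_eq_zero (Finset.mem_univ (⟨Module.finrank (ZMod 3) V, by omega⟩ : Fin k))
    simp

theorem dcount {A B : Type*} [Fintype A] [Fintype B] (R : A → B → Prop) :
    ∑ a, Nat.card {b // R a b} = ∑ b, Nat.card {a // R a b} := by
  classical
  simp only [Nat.card_eq_fintype_card, Fintype.card_subtype, Finset.card_filter]
  exact Finset.sum_comm

/-- translations lying in `H` -/
def VV {G F : Type*} [Group G] [AddCommGroup F] [Module (ZMod 3) F] (T : Multiplicative F →* G)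
    (H : Subgroup G) : Submodule (ZMod 3) F :=
  AddSubgroup.toZModSubmodule 3 (Subgroup.toAddSubgroup' (H.comap T))

theorem mem_VV {G F : Type*} [Group G] [AddCommGroup F] [Module (ZMod 3) F]
    (T : Multiplicative F →* G) (H : Subgroup G) (v : F) :
    v ∈ VV T H ↔ T (Multiplicative.ofAdd v) ∈ H := Iff.rfl

/-- subgroup of translations by `W` -/
def TW {G F : Type*} [Group G] [AddCommGroup F] [Module (ZMod 3) F] (T : Multiplicative F →* G)
    (W : Submodule (ZMod 3) F) : Subgroup G :=
  (AddSubgroup.toSubgroup W.toAddSubgroup).map T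

theorem TW_le {G F : Type*} [Group G] [AddCommGroup F] [Module (ZMod 3) F]
    (T : Multiplicative F →* G) (W : Submodule (ZMod 3) F) (H : Subgroup G) :
    TW T W ≤ H ↔ W ≤ VV T H := by
  rw [TW, Subgroup.map_le_iff_le_comap]
  exact Iff.rfl

theorem card_TW {G F : Type*} [Group G] [AddCommGroup F] [Module (ZMod 3) F]
    (T : Multiplicative F →* G) (hT : Function.Injective T) (W : Submodule (ZMod 3) F) :
    Nat.card (TW T W) = Nat.card W := by
  rw [TW, Subgroup.card_map_of_injective hT]
  rfl

theorem card_sub3 {F : Type*} [AddCommGroup F] [Module (ZMod 3) F] [Finite F]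
    (W : Submodule (ZMod 3) F) : Nat.card W = 3 ^ Module.finrank (ZMod 3) W := by
  have : Fact (Nat.Prime 3) := ⟨by norm_num⟩
  rw [Module.natCard_eq_pow_finrank (K := ZMod 3)]
  simp

theorem sumE {G F : Type*} [Group G] [AddCommGroup F] [Module (ZMod 3) F] [Finite F]
    [Finite G] [Fintype (Set G)] (T : Multiplicative F →* G) (hT : Function.Injective T)
    (hF : Nat.card F = 27) (hG : Nat.card G = 351) (k m : ℕ) (hk : k ≤ 3) (hm : 3 ^ k * m = 351) :
    ∑ S : Set G, ∏ i : Fin k,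
      (3 ^ (Module.finrank (ZMod 3) (VV T (MulAction.stabilizer G S))) - 3 ^ (i : ℕ)) =
      (∏ i : Fin k, (3 ^ 3 - 3 ^ (i : ℕ))) * 2 ^ m := by
  have : Fact (Nat.Prime 3) := ⟨by norm_num⟩
  simp_rw [← indepCount]
  have := Fintype.ofFinite {s : Fin k → F // LinearIndependent (ZMod 3) s}
  rw [dcount]
  have h3 : Module.finrank (ZMod 3) F = 3 := by
    have := Module.natCard_eq_pow_finrank (K := ZMod 3) (V := F)
    rw [hF] at this
    simp at this
    apply Nat.pow_right_injective (le_refl 2 |>.trans (by norm_num) : 2 ≤ 3)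
    simp [← this]
  have hc : Nat.card {s : Fin k → F // LinearIndependent (ZMod 3) s} =
      ∏ i : Fin k, (3 ^ 3 - 3 ^ (i : ℕ)) := by
    have := card_linearIndependent (K := ZMod 3) (V := F) (k := k) (by omega)
    simpa [h3] using this
  rw [← hc, Nat.card_eq_fintype_card, ← Finset.card_univ]
  apply Finset.sum_const_nat
  intro s _
  have hh : ∀ S : Set G, (∀ i, s.1 i ∈ VV T (MulAction.stabilizer G S)) ↔
      TW T (Submodule.span (ZMod 3) (Set.range s.1)) ≤ MulAction.stabilizer G S := by
    intro S
    rw [TW_le, Submodule.span_le, Set.range_subset_iff]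
    rfl
  simp_rw [hh]
  rw [numFixed]
  congr 1
  have h1 := Subgroup.card_mul_index (TW T (Submodule.span (ZMod 3) (Set.range s.1)))
  rw [card_TW T hT, card_sub3, finrank_span_eq_card s.2, hG, Fintype.card_fin, ← hm] at h1
  exact Nat.eq_of_mul_eq_mul_left (by positivity) h1

section core
variable {G F : Type*} [Group G] [Field F] [Module (ZMod 3) F] [Finite F] [Finite G]

theorem cardG
    (T : Multiplicative F →* G)
    (hT : Function.Injective T)
    (L : G →* Fˣ)
    (hF : Nat.card F = 27)
    (hL : Nat.card L.range = 13)
    (hker : L.ker = T.range) : Nat.card G = 351 := by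
  rw [← Subgroup.card_mul_index L.ker, Subgroup.index_ker, hL, hker,
    ← Nat.card_congr (MonoidHom.ofInjective hT).toEquiv]
  have : Nat.card (Multiplicative F) = 27 := hF
  rw [this]

theorem pow13
    (L : G →* Fˣ)
    (hL : Nat.card L.range = 13) (g : G) : L g ^ 13 = 1 := by
  have : (⟨L g, g, rfl⟩ : L.range) ^ 13 = 1 := by
    rw [← hL]; exact pow_card_eq_one'
  exact congrArg Subtype.val this

theorem order13
    (T : Multiplicative F →* G)
    (hT : Function.Injective T)
    (L : G →* Fˣ)
    (hL : Nat.card L.range = 13)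
    (hker : L.ker = T.range)
    (hconj : ∀ g v, g * T (Multiplicative.ofAdd v) * g⁻¹ = T (Multiplicative.ofAdd (L g * v))) (g : G) (hg : L g ≠ 1) : orderOf g = 13 := by
  have : Fact (Nat.Prime 13) := ⟨by norm_num⟩
  apply orderOf_eq_prime
  · have h1 : g ^ 13 ∈ L.ker := by
      rw [MonoidHom.mem_ker, map_pow, pow13 L hL]
    rw [hker] at h1
    obtain ⟨b, hb⟩ := h1
    have h2 := hconj g (Multiplicative.toAdd b)
    rw [ofAdd_toAdd, hb] at h2
    have h3 : g * g ^ 13 * g⁻¹ = g ^ 13 := by group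
    rw [h3, ← hb] at h2
    have h4 := congrArg Multiplicative.toAdd (hT h2)
    rw [toAdd_ofAdd] at h4
    have h5 : ((L g : F) - 1) * Multiplicative.toAdd b = 0 := by linear_combination -h4
    rcases mul_eq_zero.1 h5 with h | h
    · exact absurd (Units.ext (by simpa using sub_eq_zero.1 h)) hg
    · rw [← hb]
      have : b = 1 := h
      rw [this, map_one]
  · rintro rfl
    simp at hg

/-- number of non-translations in `H` -/
noncomputable def YY (L : G →* Fˣ) (H : Subgroup G) : ℕ := Nat.card {g : G // g ∈ H ∧ L g ≠ 1}

theorem sumY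
    (T : Multiplicative F →* G)
    (hT : Function.Injective T)
    (L : G →* Fˣ)
    (hF : Nat.card F = 27)
    (hL : Nat.card L.range = 13)
    (hker : L.ker = T.range)
    (hconj : ∀ g v, g * T (Multiplicative.ofAdd v) * g⁻¹ = T (Multiplicative.ofAdd (L g * v))) [Fintype (Set G)] :
    ∑ S : Set G, YY L (MulAction.stabilizer G S) = 324 * 2 ^ 27 := by
  have hG := cardG T hT L hF hL hker
  have e : ∀ S : Set G, YY L (MulAction.stabilizer G S) =
      Nat.card {g : {g : G // L g ≠ 1} // g.1 ∈ MulAction.stabilizer G S} := by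
    intro S
    rw [YY]
    apply Nat.card_congr
    exact ((Equiv.subtypeSubtypeEquivSubtypeInter (fun g : G => L g ≠ 1)
      (fun g => g ∈ MulAction.stabilizer G S)).trans
        (Equiv.subtypeEquivRight (fun g => and_comm))).symm
  simp_rw [e]
  have := Fintype.ofFinite {g : G // L g ≠ 1}
  rw [dcount]
  have hc : Nat.card {g : G // L g ≠ 1} = 324 := by
    classical
    have := Fintype.ofFinite G
    have h1 : Nat.card L.ker = 27 := by
      rw [hker, ← Nat.card_congr (MonoidHom.ofInjective hT).toEquiv]
      exact hF
    have h2 : Nat.card {g : G // L g = 1} = 27 := h1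
    have h3 := Fintype.card_subtype_compl (fun g : G => L g = 1)
    simp only [← Nat.card_eq_fintype_card] at h3
    rw [h2, hG] at h3
    exact h3
  rw [← hc, Nat.card_eq_fintype_card, ← Finset.card_univ]
  apply Finset.sum_const_nat
  intro g _
  simp_rw [← Subgroup.zpowers_le]
  rw [numFixed]
  congr 1
  have h1 := Subgroup.card_mul_index (Subgroup.zpowers g.1)
  rw [Nat.card_zpowers, order13 T hT L hL hker hconj g.1 g.2, hG] at h1
  omega

theorem YY_add
    (T : Multiplicative F →* G)
    (hT : Function.Injective T)
    (L : G →* Fˣ)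
    (hker : L.ker = T.range) (H : Subgroup G) :
    YY L H + 3 ^ Module.finrank (ZMod 3) (VV T H) = Nat.card H ∧
    Nat.card H = Nat.card (H.map L) * 3 ^ Module.finrank (ZMod 3) (VV T H) := by
  have h1 : Nat.card {g : G // g ∈ H ∧ L g = 1} = 3 ^ Module.finrank (ZMod 3) (VV T H) := by
    rw [← card_sub3, ← card_TW T hT]
    apply Nat.card_congr
    apply Equiv.subtypeEquivRight
    intro g
    rw [← MonoidHom.mem_ker, hker, TW, Subgroup.mem_map]
    constructor
    · rintro ⟨h, b, rfl⟩
      exact ⟨b, h, rfl⟩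
    · rintro ⟨b, h, rfl⟩
      exact ⟨h, b, rfl⟩
  constructor
  · rw [← h1, YY]
    classical
    have := Fintype.ofFinite G
    have := Fintype.ofFinite H
    have h2 := Finset.card_filter_add_card_filter_not (s := Finset.univ.filter (fun g => g ∈ H))
      (fun g : G => L g = 1)
    rw [Finset.filter_filter, Finset.filter_filter] at h2
    have h3 : Nat.card H = (Finset.univ.filter (fun g => g ∈ H)).card := by
      rw [← Fintype.card_subtype, ← Nat.card_eq_fintype_card]
    rw [h3, ← h2, Nat.card_eq_fintype_card, Nat.card_eq_fintype_card, Fintype.card_subtype,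
      Fintype.card_subtype, add_comm]
  · rw [← h1, ← Subgroup.relIndex_ker, ← Subgroup.inf_relIndex_right, 
      mul_comm, show Nat.card {g : G // g ∈ H ∧ L g = 1} = Nat.card (L.ker ⊓ H : Subgroup G) from ?_]
    · rw [← Subgroup.relIndex_bot_left, ← Subgroup.relIndex_bot_left]
      exact (Subgroup.relIndex_mul_relIndex _ _ _ bot_le inf_le_right).symm
    · apply Nat.card_congr
      apply Equiv.subtypeEquivRight
      intro g
      exact and_comm

theorem finrank_three
    (T : Multiplicative F →* G)
    (L : G →* Fˣ)
    (hF : Nat.card F = 27)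
    (hL : Nat.card L.range = 13)
    (hconj : ∀ g v, g * T (Multiplicative.ofAdd v) * g⁻¹ = T (Multiplicative.ofAdd (L g * v))) (H : Subgroup G) (h1 : Nat.card (H.map L) ≠ 1)
    (h2 : Module.finrank (ZMod 3) (VV T H) ≠ 0) : Module.finrank (ZMod 3) (VV T H) = 3 := by
  have : Fact (Nat.Prime 3) := ⟨by norm_num⟩
  have : Fact (Nat.Prime 13) := ⟨by norm_num⟩
  have hV : VV T H ≠ ⊥ := by
    intro h; rw [h] at h2; simp at h2
  obtain ⟨v, hv, hv0⟩ := (Submodule.ne_bot_iff _).1 hV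
  have hM : H.map L ≠ ⊥ := by
    intro h; rw [h] at h1; simp at h1
  obtain ⟨⟨x, g, hg, hgx⟩, hx⟩ := (Subgroup.ne_bot_iff_exists_ne_one).1 hM
  have hg1 : L g ≠ 1 := by
    intro h; apply hx; ext1; simp [← hgx, h]
  have ho : orderOf (L g) = 13 := orderOf_eq_prime (pow13 L hL g) hg1
  have hle : Nat.card (Subgroup.zpowers (L g)) ≤ Nat.card (VV T H) := by
    apply Nat.card_le_card_of_injective
      (fun u : Subgroup.zpowers (L g) => (⟨(u.1 : F) * v, by
        obtain ⟨u, n, hn⟩ := u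
        rw [mem_VV]
        have := hconj (g ^ n) v
        rw [map_zpow] at this
        simp only at hn
        rw [hn] at this
        rw [← this]
        exact H.mul_mem (H.mul_mem (H.zpow_mem hg n) hv) (H.inv_mem (H.zpow_mem hg n))⟩ : VV T H))
    intro a b hab
    have := congrArg Subtype.val hab
    simp only at this
    exact Subtype.ext (Units.ext (mul_right_cancel₀ hv0 this))
  rw [Nat.card_zpowers, ho, card_sub3] at hle
  have hup : Nat.card (VV T H) ≤ Nat.card F := Nat.card_le_card_of_injective _ Subtype.val_injective
  rw [card_sub3, hF] at hup
  generalize Module.finrank (ZMod 3) (VV T H) = d at *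
  have : d ≤ 3 := (Nat.pow_le_pow_iff_right (by norm_num : 1 < 3)).1 hup
  interval_cases d <;> omega

open Classical in
theorem pointwise
    (T : Multiplicative F →* G)
    (hT : Function.Injective T)
    (L : G →* Fˣ)
    (hF : Nat.card F = 27)
    (hL : Nat.card L.range = 13)
    (hker : L.ker = T.range)
    (hconj : ∀ g v, g * T (Multiplicative.ofAdd v) * g⁻¹ = T (Multiplicative.ofAdd (L g * v))) (S : Set G) :
    (1248 : ℤ) * (if MulAction.stabilizer G S = ⊥ then 1 else 0) =
    1248 - 624 * ((∏ i : Fin 1, (3 ^ (Module.finrank (ZMod 3)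
        (VV T (MulAction.stabilizer G S))) - 3 ^ (i : ℕ)) : ℕ) : ℤ)
     + 78 * ((∏ i : Fin 2, (3 ^ (Module.finrank (ZMod 3)
        (VV T (MulAction.stabilizer G S))) - 3 ^ (i : ℕ)) : ℕ) : ℤ)
     - 3 * ((∏ i : Fin 3, (3 ^ (Module.finrank (ZMod 3)
        (VV T (MulAction.stabilizer G S))) - 3 ^ (i : ℕ)) : ℕ) : ℤ)
     - 104 * (YY L (MulAction.stabilizer G S) : ℤ)
     + 33696 * (if S = ∅ ∨ S = Set.univ then 1 else 0) := by
  have hG := cardG T hT L hF hL hker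
  have htop : (S = ∅ ∨ S = Set.univ) ↔ Nat.card (MulAction.stabilizer G S) = 351 := by
    rw [← hG, Subgroup.card_eq_iff_eq_top]
    constructor
    · rintro (rfl | rfl) <;> ext g <;> simp
    · intro h
      by_contra! hc
      obtain ⟨⟨x, hx⟩, h2⟩ := hc
      apply h2
      ext y
      simp only [Set.mem_univ, iff_true]
      have h3 : y * x⁻¹ ∈ MulAction.stabilizer G S := by rw [h]; trivial
      rw [MulAction.mem_stabilizer_iff] at h3
      rw [← h3]
      exact ⟨x, hx, by simp⟩
  have hbot : MulAction.stabilizer G S = ⊥ ↔ Nat.card (MulAction.stabilizer G S) = 1 := 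
    Subgroup.card_eq_one.symm
  simp only [hbot, htop]
  generalize MulAction.stabilizer G S = H
  obtain ⟨h1, h2⟩ := YY_add T hT L hker H
  have h3 := finrank_three T L hF hL hconj H
  have h4 : Nat.card (H.map L) ∣ 13 := by
    rw [← hL]
    apply Subgroup.card_dvd_of_le
    rintro _ ⟨g, -, rfl⟩
    exact ⟨g, rfl⟩
  have hup : Nat.card (VV T H) ≤ Nat.card F := Nat.card_le_card_of_injective _ Subtype.val_injective
  rw [card_sub3, hF] at hup
  generalize Module.finrank (ZMod 3) (VV T H) = d at *
  have hd : d ≤ 3 := (Nat.pow_le_pow_iff_right (by norm_num : 1 < 3)).1 hup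
  generalize YY L H = y at *
  generalize Nat.card H = n at *
  simp only [Fin.prod_univ_succ, Fin.prod_univ_zero]
  rcases (Nat.dvd_prime (by norm_num)).1 h4 with h | h
  · rw [h, one_mul] at h2
    subst h2
    have : y = 0 := by omega
    subst this
    interval_cases d <;> simp
  · rw [h] at h2 h3
    have : d = 0 ∨ d = 3 := by
      by_cases hd : d = 0
      · exact Or.inl hd
      · exact Or.inr (h3 (by norm_num) hd)
    rcases this with rfl | rfl
    · have : y = 12 := by omega
      subst this; subst h2; simp
    · have : y = 324 := by omega
      subst this; subst h2; simp

set_option exponentiation.threshold 1000 in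
theorem total
    (T : Multiplicative F →* G)
    (hT : Function.Injective T)
    (L : G →* Fˣ)
    (hF : Nat.card F = 27)
    (hL : Nat.card L.range = 13)
    (hker : L.ker = T.range)
    (hconj : ∀ g v, g * T (Multiplicative.ofAdd v) * g⁻¹ = T (Multiplicative.ofAdd (L g * v))) : ({ S : Set G | MulAction.stabilizer G S = ⊥ }.ncard : ℤ) =
      2 ^ 351 - 13 * 2 ^ 117 + 39 * 2 ^ 39 - 27 * (2 ^ 27 + 2 ^ 13 - 2) := by
  classical
  have hG := cardG T hT L hF hL hker
  have := Fintype.ofFinite G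
  have hset : Nat.card (Set G) = 2 ^ 351 := by
    rw [Nat.card_eq_fintype_card, Fintype.card_set, ← Nat.card_eq_fintype_card, hG]
  have inst : Fintype (Set G) := Fintype.ofFinite _
  have hs := Finset.sum_congr (rfl : (Finset.univ : Finset (Set G)) = Finset.univ)
    (fun S _ => pointwise T hT L hF hL hker hconj S)
  rw [Finset.sum_add_distrib, Finset.sum_sub_distrib, Finset.sum_sub_distrib,
    Finset.sum_add_distrib, Finset.sum_sub_distrib] at hs
  simp only [← Finset.mul_sum, ← Nat.cast_sum] at hs
  rw [sumE T hT hF hG 1 117 (by norm_num) (by norm_num),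
    sumE T hT hF hG 2 39 (by norm_num) (by norm_num),
    sumE T hT hF hG 3 13 (by norm_num) (by norm_num),
    sumY T hT L hF hL hker hconj] at hs
  have hc : ∑ S : Set G, (1248 : ℤ) = 1248 * 2 ^ 351 := by
    rw [Finset.sum_const, Finset.card_univ, ← Nat.card_eq_fintype_card, hset]
    simp [mul_comm]
  have h2 : ∑ S : Set G, (if S = ∅ ∨ S = Set.univ then (1 : ℤ) else 0) = 2 := by
    have hne : (∅ : Set G) ≠ Set.univ := Set.empty_ne_univ
    rw [← Finset.sum_filter, Finset.sum_const]
    rw [show (Finset.univ.filter (fun S : Set G => S = ∅ ∨ S = Set.univ)) = {∅, Set.univ} by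
      ext; simp]
    rw [Finset.card_pair hne]
    simp
  have h0 : ∑ S : Set G, (if MulAction.stabilizer G S = ⊥ then (1 : ℤ) else 0) =
      ({ S : Set G | MulAction.stabilizer G S = ⊥ }.ncard : ℤ) := by
    rw [← Finset.sum_filter, Finset.sum_const, ← Set.ncard_coe_finset]
    simp
  rw [hc, h2, h0] at hs
  simp only [Fin.prod_univ_succ, Fin.prod_univ_zero] at hs
  push_cast at hs
  norm_num [-Nat.reducePow, -Int.reducePow] at hs ⊢
  omega
end core

theorem F27_card : Nat.card F27 = 27 := by
  rw [GaloisField.card 3 3 (by norm_num)]; norm_num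

theorem F27_finite : Finite F27 := Nat.finite_of_card_ne_zero (by rw [F27_card]; norm_num)

set_option exponentiation.threshold 1000 in
theorem statement17 (G : Subgroup (Equiv.Perm F27))
    (hG : (G : Set (Equiv.Perm F27)) = affineSet) :
    { S : Set G | MulAction.stabilizer G S = ⊥ }.ncard =
      2 ^ 351 - 13 * 2 ^ 117 + 39 * 2 ^ 39 - 27 * (2 ^ 27 + 2 ^ 13 - 2) := by
  have := F27_finite
  have hmem : ∀ g : Equiv.Perm F27, g ∈ G ↔
      ∃ a b : F27, IsNonzeroSquare a ∧ ∀ x : F27, g x = a * x + b := by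
    intro g
    rw [← SetLike.mem_coe, hG]
    rfl
  have haff : ∀ (g : G) (x : F27), g.1 x = (g.1 1 - g.1 0) * x + g.1 0 := by
    intro g x
    obtain ⟨a, b, -, h⟩ := (hmem g.1).1 g.2
    rw [h, h, h]; ring
  have hsq : ∀ g : G, IsNonzeroSquare (g.1 1 - g.1 0) := by
    intro g
    obtain ⟨a, b, ha, h⟩ := (hmem g.1).1 g.2
    rw [h, h]
    simpa using ha
  let T : Multiplicative F27 →* G :=
    { toFun := fun v => ⟨Equiv.addRight (Multiplicative.toAdd v), (hmem _).2
        ⟨1, Multiplicative.toAdd v, ⟨one_ne_zero, 1, by simp⟩, fun x => by simp⟩⟩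
      map_one' := by ext x; simp
      map_mul' := by
        intro v w; ext x; simp [add_comm, add_left_comm] }
  have hTv : ∀ v x, (T v).1 x = x + Multiplicative.toAdd v := fun v x => rfl
  have hT : Function.Injective T := by
    intro v w h
    have := congrArg (fun g : G => g.1 0) h
    simp only [hTv, zero_add] at this
    exact this
  let L0 : G →* F27 :=
    { toFun := fun g => g.1 1 - g.1 0
      map_one' := by simp
      map_mul' := by
        intro g h
        have h1 := haff g (h.1 1)
        have h2 := haff g (h.1 0)
        change g.1 (h.1 1) - g.1 (h.1 0) = _
        rw [h1, h2]; ring }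
  let L : G →* F27ˣ := L0.toHomUnits
  have hLv : ∀ g, (L g : F27) = g.1 1 - g.1 0 := fun g => rfl
  have hker : L.ker = T.range := by
    ext g
    rw [MonoidHom.mem_ker, MonoidHom.mem_range, Units.ext_iff, hLv]
    constructor
    · intro h
      refine ⟨Multiplicative.ofAdd (g.1 0), ?_⟩
      ext x
      rw [hTv, haff g x, h]; simp
    · rintro ⟨v, rfl⟩
      rw [hTv, hTv]; simp
  have hconj : ∀ g v, g * T (Multiplicative.ofAdd v) * g⁻¹ =
      T (Multiplicative.ofAdd (L g * v)) := by
    intro g v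
    rw [mul_inv_eq_iff_eq_mul]
    ext x
    change g.1 ((T _).1 x) = (T _).1 (g.1 x)
    rw [hTv, hTv, haff g, haff g x, hLv]
    simp only [toAdd_ofAdd]
    ring
  have hL : Nat.card L.range = 13 := by
    have hr : L.range = (powMonoidHom 2 : F27ˣ →* F27ˣ).range := by
      ext u
      constructor
      · rintro ⟨g, rfl⟩
        obtain ⟨h0, c, hc⟩ := hsq g
        have hc0 : c ≠ 0 := by rintro rfl; apply h0; rw [hc]; simp
        refine ⟨Units.mk0 c hc0, ?_⟩
        ext
        rw [hLv, hc]
        simp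
      · rintro ⟨c, rfl⟩
        refine ⟨⟨Units.mulLeft (c ^ 2), (hmem _).2 ⟨(c : F27) ^ 2, 0, ⟨by simp, c, rfl⟩,
          fun x => by simp⟩⟩, ?_⟩
        ext
        rw [hLv]
        simp
    have hu : Nat.card F27ˣ = 26 := by
      rw [Nat.card_units, F27_card]
    rw [hr, IsCyclic.card_powMonoidHom_range, hu]
    norm_num
  have key := total T hT L F27_card hL hker hconj
  zify
  omega
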